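/- Let G = ⟨τ⟩ have order 2, R₂ = Z_(2)[G], and let I ⊆ R₂ be an ideal of finite index with I·S₂ generated by α = 2^i(1+τ)/2 + 2^j(1-τ)/2, where S₂ is the maximal order. Then I is either the principal ideal (α) or the ideal generated by α(1+τ)/2 and α(1-τ)/2. -/

import Mathlib

/-- The group `G` of order two. -/
abbrev Gtwo := Multiplicative (ZMod 2)
/-- The nontrivial element `τ` inside the group algebra `ℚ[G]`. -/
noncomputable def tauQ : MonoidAlgebra ℚ Gtwo :=
  MonoidAlgebra.of ℚ Gtwo (Multiplicative.ofAdd 1)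

/-- The idempotent `e⁺ = (1+τ)/2` of `ℚ[G]`. -/
noncomputable def eplus : MonoidAlgebra ℚ Gtwo := (2 : ℚ)⁻¹ • (1 + tauQ)

/-- The idempotent `e⁻ = (1-τ)/2` of `ℚ[G]`. -/
noncomputable def eminus : MonoidAlgebra ℚ Gtwo := (2 : ℚ)⁻¹ • (1 - tauQ)

/-- The localization `ℤ_(2)` of `ℤ` at 2, realized as the subring of `ℚ`
generated by the inverses of odd integers. -/
def Zloc : Subring ℚ := Subring.closure {q : ℚ | ∃ n : ℤ, ¬(2 ∣ n) ∧ q * n = 1}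

/-- `R₂ = ℤ_(2)[G] = ℤ_(2)·1 ⊕ ℤ_(2)·τ`, as a subring of `ℚ[G]`. -/
noncomputable def RtwoSub : Subring (MonoidAlgebra ℚ Gtwo) :=
  Subring.closure
    {x | ∃ a b : ℚ, a ∈ Zloc ∧ b ∈ Zloc ∧ x = a • (1 : MonoidAlgebra ℚ Gtwo) + b • tauQ}

/-- `S₂ = ℤ_(2)·(1+τ)/2 ⊕ ℤ_(2)·(1-τ)/2`, the maximal order in `ℚ[G]`
localized at 2, as a subring of `ℚ[G]`. -/
noncomputable def StwoSub : Subring (MonoidAlgebra ℚ Gtwo) :=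
  Subring.closure {x | ∃ a b : ℚ, a ∈ Zloc ∧ b ∈ Zloc ∧ x = a • eplus + b • eminus}

lemma exists_half_of_mem_Zloc {q : ℚ} (hq : q ∈ Zloc) :
    ∃ k ∈ Zloc, q = 2 * k ∨ q = 2 * k + 1 := by
  induction hq using Subring.closure_induction with
  | mem q h =>
    have hq : q ∈ Zloc := Subring.subset_closure h
    obtain ⟨n, hn, h⟩ := h
    obtain ⟨m, rfl⟩ : ∃ m, n = 2 * m + 1 := ⟨n / 2, by omega⟩
    refine ⟨-(m * q), neg_mem (mul_mem (intCast_mem _ m) hq), Or.inr ?_⟩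
    push_cast at h
    linear_combination h
  | zero => exact ⟨0, zero_mem _, by simp⟩
  | one => exact ⟨0, zero_mem _, by simp⟩
  | add x y _ _ hx hy =>
    obtain ⟨k, hk, hx⟩ := hx
    obtain ⟨l, hl, hy⟩ := hy
    have hkl := add_mem hk hl
    rcases hx with rfl | rfl <;> rcases hy with rfl | rfl
    · exact ⟨k + l, hkl, Or.inl (by ring)⟩
    · exact ⟨k + l, hkl, Or.inr (by ring)⟩
    · exact ⟨k + l, hkl, Or.inr (by ring)⟩
    · exact ⟨k + l + 1, add_mem hkl (one_mem _), Or.inl (by ring)⟩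
  | neg x _ hx =>
    obtain ⟨k, hk, rfl | rfl⟩ := hx
    · exact ⟨-k, neg_mem hk, Or.inl (by ring)⟩
    · exact ⟨-k - 1, sub_mem (neg_mem hk) (one_mem _), Or.inr (by ring)⟩
  | mul x y hxm hym hx hy =>
    obtain ⟨k, hk, rfl | rfl⟩ := hx
    · exact ⟨k * y, mul_mem hk hym, Or.inl (by ring)⟩
    · obtain ⟨l, hl, rfl | rfl⟩ := hy
      · exact ⟨(2 * k + 1) * l, mul_mem hxm hl, Or.inl (by ring)⟩
      · exact ⟨k * (2 * l + 1) + l, add_mem (mul_mem hk hym) hl, Or.inr (by ring)⟩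

lemma exists_odd_mul_eq_intCast_of_mem_Zloc {q : ℚ} (hq : q ∈ Zloc) :
    ∃ n m : ℤ, Odd n ∧ q * n = m := by
  induction hq using Subring.closure_induction with
  | mem q h =>
    obtain ⟨n, hn, h⟩ := h
    exact ⟨n, 1, by rwa [← Int.not_even_iff_odd, even_iff_two_dvd], by simpa using h⟩
  | zero => exact ⟨1, 0, odd_one, by simp⟩
  | one => exact ⟨1, 1, odd_one, by simp⟩
  | add x y _ _ hx hy =>
    obtain ⟨n, m, hn, hx⟩ := hx
    obtain ⟨n', m', hn', hy⟩ := hy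
    refine ⟨n * n', m * n' + m' * n, hn.mul hn', ?_⟩
    push_cast
    linear_combination (n' : ℚ) * hx + (n : ℚ) * hy
  | neg x _ hx =>
    obtain ⟨n, m, hn, hx⟩ := hx
    exact ⟨n, -m, hn, by push_cast; linear_combination -hx⟩
  | mul x y _ _ hx hy =>
    obtain ⟨n, m, hn, hx⟩ := hx
    obtain ⟨n', m', hn', hy⟩ := hy
    refine ⟨n * n', m * m', hn.mul hn', ?_⟩
    push_cast
    rw [← hx, ← hy]
    ring

lemma two_mul_ne_one_of_mem_Zloc {k : ℚ} (hk : k ∈ Zloc) : 2 * k ≠ 1 := by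
  intro h
  obtain ⟨n, m, hn, hm⟩ := exists_odd_mul_eq_intCast_of_mem_Zloc hk
  have : n = 2 * m := by
    have : (n : ℚ) = 2 * m := by rw [← hm]; linear_combination (-(n : ℚ)) * h
    exact_mod_cast this
  exact (Int.not_even_iff_odd.2 hn) (this ▸ even_two_mul m)

/-- The sign character of the group of order two. -/
def signChar : Gtwo →* ℚ where
  toFun g := if g = 1 then 1 else -1
  map_one' := by simp
  map_mul' := by
    intro a b
    have h : ∀ a b : Gtwo, (a * b = 1) ↔ (a = 1 ↔ b = 1) := by decide
    simp only [h]
    by_cases ha : a = 1 <;> by_cases hb : b = 1 <;> simp [ha, hb]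

/-- The ring homomorphism `ℚ[G] → ℚ` sending `τ` to `1`. -/
noncomputable def evalPlus : MonoidAlgebra ℚ Gtwo →ₐ[ℚ] ℚ := MonoidAlgebra.lift ℚ ℚ Gtwo 1

/-- The ring homomorphism `ℚ[G] → ℚ` sending `τ` to `-1`. -/
noncomputable def evalMinus : MonoidAlgebra ℚ Gtwo →ₐ[ℚ] ℚ :=
  MonoidAlgebra.lift ℚ ℚ Gtwo signChar

@[simp] lemma evalPlus_tauQ : evalPlus tauQ = 1 := by
  simp [evalPlus, tauQ]

@[simp] lemma evalMinus_tauQ : evalMinus tauQ = -1 := by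
  simp [evalMinus, tauQ, signChar]

@[simp] lemma evalPlus_eplus : evalPlus eplus = 1 := by
  simp only [eplus, map_smul, map_add, map_one, evalPlus_tauQ, smul_eq_mul]
  norm_num

@[simp] lemma evalMinus_eplus : evalMinus eplus = 0 := by
  simp [eplus]

@[simp] lemma evalPlus_eminus : evalPlus eminus = 0 := by
  simp [eminus]

@[simp] lemma evalMinus_eminus : evalMinus eminus = 1 := by
  simp only [eminus, map_smul, map_sub, map_one, evalMinus_tauQ, smul_eq_mul]
  norm_num

lemma eq_evalPlus_smul_add_evalMinus_smul (x : MonoidAlgebra ℚ Gtwo) :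
    x = evalPlus x • eplus + evalMinus x • eminus := by
  induction x using MonoidAlgebra.induction_on with
  | of g =>
    have hg : ∀ g : Gtwo, g = 1 ∨ g = Multiplicative.ofAdd 1 := by decide
    rcases hg g with rfl | rfl
    · rw [map_one, map_one, map_one, one_smul, one_smul, eplus, eminus]
      module
    · change tauQ = evalPlus tauQ • eplus + evalMinus tauQ • eminus
      rw [evalPlus_tauQ, evalMinus_tauQ, eplus, eminus]
      module
  | add x y hx hy =>
    rw [map_add, map_add]
    nth_rewrite 1 [hx, hy]
    module
  | smul r x hx =>
    rw [map_smul, map_smul]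
    nth_rewrite 1 [hx]
    simp only [smul_eq_mul]
    module

lemma ext_evalPlus_evalMinus {x y : MonoidAlgebra ℚ Gtwo} (hp : evalPlus x = evalPlus y)
    (hm : evalMinus x = evalMinus y) : x = y := by
  rw [eq_evalPlus_smul_add_evalMinus_smul x, eq_evalPlus_smul_add_evalMinus_smul y, hp, hm]

lemma mem_StwoSub_iff {x : MonoidAlgebra ℚ Gtwo} :
    x ∈ StwoSub ↔ evalPlus x ∈ Zloc ∧ evalMinus x ∈ Zloc := by
  constructor
  · intro hx
    have : StwoSub ≤ Zloc.comap (evalPlus : MonoidAlgebra ℚ Gtwo →+* ℚ) ⊓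
        Zloc.comap (evalMinus : MonoidAlgebra ℚ Gtwo →+* ℚ) := by
      refine Subring.closure_le.2 ?_
      rintro _ ⟨a, b, ha, hb, rfl⟩
      simp [ha, hb]
    simpa [Subring.mem_inf] using this hx
  · rintro ⟨hp, hm⟩
    exact Subring.subset_closure ⟨_, _, hp, hm, eq_evalPlus_smul_add_evalMinus_smul x⟩

lemma mem_RtwoSub_iff {x : MonoidAlgebra ℚ Gtwo} :
    x ∈ RtwoSub ↔ evalMinus x ∈ Zloc ∧ ∃ k ∈ Zloc, evalPlus x = evalMinus x + 2 * k := by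
  constructor
  · intro hx
    induction hx using Subring.closure_induction with
    | mem x h =>
      obtain ⟨a, b, ha, hb, rfl⟩ := h
      simp only [map_add, map_smul, map_one, evalPlus_tauQ, evalMinus_tauQ, smul_eq_mul]
      exact ⟨add_mem (mul_mem ha (one_mem _)) (mul_mem hb (neg_mem (one_mem _))), b, hb, by ring⟩
    | zero => exact ⟨by simp [zero_mem], 0, zero_mem _, by simp⟩
    | one => exact ⟨by simp [one_mem], 0, zero_mem _, by simp⟩
    | add x y _ _ hx hy =>
      obtain ⟨hx, k, hk, hxk⟩ := hx
      obtain ⟨hy, l, hl, hyl⟩ := hy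
      simp only [map_add, hxk, hyl]
      exact ⟨add_mem hx hy, k + l, add_mem hk hl, by ring⟩
    | neg x _ hx =>
      obtain ⟨hx, k, hk, hxk⟩ := hx
      simp only [map_neg, hxk]
      exact ⟨neg_mem hx, -k, neg_mem hk, by ring⟩
    | mul x y _ _ hx hy =>
      obtain ⟨hx, k, hk, hxk⟩ := hx
      obtain ⟨hy, l, hl, hyl⟩ := hy
      simp only [map_mul, hxk, hyl]
      exact ⟨mul_mem hx hy, evalMinus x * l + k * (evalMinus y + 2 * l),
        add_mem (mul_mem hx hl) (mul_mem hk (add_mem hy (mul_mem (ofNat_mem _ 2) hl))), by ring⟩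
  · rintro ⟨hm, k, hk, hx⟩
    refine Subring.subset_closure ⟨evalMinus x + k, k, add_mem hm hk, hk, ?_⟩
    apply ext_evalPlus_evalMinus
    · simp [hx]; ring
    · simp

/-- An additive subgroup of `ℤ_(2) × ℤ_(2)` that contains twice the whole lattice and surjects
onto both residue fields contains `(1, 1)`, and it is either the whole lattice or contained in the
congruence subgroup. -/
lemma AddSubgroup.one_mem_and_or_congr (N : AddSubgroup (ℚ × ℚ))
    (hN : ∀ p ∈ N, p.1 ∈ Zloc ∧ p.2 ∈ Zloc)
    (htwo : ∀ a ∈ Zloc, ∀ b ∈ Zloc, (2 * a, 2 * b) ∈ N)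
    (hfst : ∃ p ∈ N, ∃ k ∈ Zloc, p.1 = 2 * k + 1)
    (hsnd : ∃ p ∈ N, ∃ k ∈ Zloc, p.2 = 2 * k + 1) :
    (1, 1) ∈ N ∧ (((1, 0) ∈ N ∧ (0, 1) ∈ N) ∨
      ∀ p ∈ N, ∃ k ∈ Zloc, p.1 = p.2 + 2 * k) := by
  have red : ∀ a ∈ Zloc, ∀ b ∈ Zloc, ∀ u v, (2 * a + u, 2 * b + v) ∈ N → (u, v) ∈ N := by
    intro a ha b hb u v h
    simpa using sub_mem h (htwo a ha b hb)
  have hone : ((1, 1) : ℚ × ℚ) ∈ N := by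
    obtain ⟨⟨_, v⟩, hp, k, hk, rfl⟩ := hfst
    obtain ⟨⟨u, _⟩, hq, l, hl, rfl⟩ := hsnd
    obtain ⟨m, hm, hv⟩ := exists_half_of_mem_Zloc (hN _ hp).2
    obtain ⟨n, hn, hu⟩ := exists_half_of_mem_Zloc (hN _ hq).1
    dsimp only at hu hv
    rcases hv with rfl | rfl
    · have h1 : ((1, 0) : ℚ × ℚ) ∈ N := red k hk m hm _ _ (by simpa using hp)
      rcases hu with rfl | rfl
      · have h2 : ((0, 1) : ℚ × ℚ) ∈ N := red n hn l hl _ _ (by simpa using hq)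
        simpa using add_mem h1 h2
      · exact red n hn l hl _ _ hq
    · exact red k hk m hm _ _ hp
  refine ⟨hone, ?_⟩
  by_cases h10 : ((1, 0) : ℚ × ℚ) ∈ N
  · exact Or.inl ⟨h10, by simpa using sub_mem hone h10⟩
  refine Or.inr ?_
  rintro ⟨u, v⟩ hp
  obtain ⟨m, hm, hu⟩ := exists_half_of_mem_Zloc (hN _ hp).1
  obtain ⟨n, hn, hv⟩ := exists_half_of_mem_Zloc (hN _ hp).2
  dsimp only at hu hv ⊢
  rcases hu with rfl | rfl <;> rcases hv with rfl | rfl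
  · exact ⟨m - n, sub_mem hm hn, by ring⟩
  · have h2 : ((0, 1) : ℚ × ℚ) ∈ N := red m hm n hn _ _ (by simpa using hp)
    exact absurd (by simpa using sub_mem hone h2) h10
  · exact absurd (red m hm n hn _ _ (by simpa using hp)) h10
  · exact ⟨m - n, sub_mem hm hn, by ring⟩

/-- If the extension of `I` along `f` is generated by `α`, then a `ℤ_(2)`-valued character of the
target takes on some element of `I` an odd multiple of its value at `α`. -/
lemma exists_odd_multiple_of_map_eq_span {R S : Type*} [CommRing R] [CommRing S] (f : R →+* S)
    (I : Ideal R) (α : S) (hgen : Ideal.map f I = Ideal.span {α}) (φ : S →+* ℚ)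
    (hφ : ∀ s, φ s ∈ Zloc) (hα : φ α ≠ 0) :
    ∃ x ∈ I, ∃ k ∈ Zloc, φ (f x) = φ α * (2 * k + 1) := by
  by_contra! hcon
  let J : Ideal S :=
    { carrier := {y | ∃ k ∈ Zloc, φ y = φ α * (2 * k)}
      zero_mem' := ⟨0, zero_mem _, by simp⟩
      add_mem' := by
        rintro x y ⟨k, hk, hx⟩ ⟨l, hl, hy⟩
        exact ⟨k + l, add_mem hk hl, by rw [map_add, hx, hy]; ring⟩
      smul_mem' := by
        rintro s x ⟨k, hk, hx⟩
        exact ⟨φ s * k, mul_mem (hφ s) hk, by rw [smul_eq_mul, map_mul, hx]; ring⟩ }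
  have hJ : Ideal.map f I ≤ J := by
    refine Ideal.map_le_iff_le_comap.2 fun x hx => ?_
    have hxα : f x ∈ Ideal.span {α} := hgen ▸ Ideal.mem_map_of_mem f hx
    obtain ⟨s, hs⟩ := Ideal.mem_span_singleton'.1 hxα
    have hval : φ (f x) = φ α * φ s := by rw [← hs, map_mul, mul_comm]
    obtain ⟨k, hk, h | h⟩ := exists_half_of_mem_Zloc (hφ s)
    · exact ⟨k, hk, by rw [hval, h]⟩
    · exact absurd (by rw [hval, h]) (hcon x hx k hk)
  obtain ⟨k, hk, h⟩ := hJ (hgen ▸ Ideal.mem_span_singleton_self α)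
  exact two_mul_ne_one_of_mem_Zloc hk (mul_left_cancel₀ hα (by rw [← h, mul_one]))

/-- Multiplying an element of the extension of `I` to `S₂` by an element of `2 S₂` gives an
element of `I`. -/
lemma exists_mem_eval_eq_two_mul (hRS : RtwoSub ≤ StwoSub) (I : Ideal RtwoSub) {y : StwoSub}
    (hy : y ∈ Ideal.map (Subring.inclusion hRS) I) {a b : ℚ} (ha : a ∈ Zloc) (hb : b ∈ Zloc) :
    ∃ x ∈ I, evalPlus (x : MonoidAlgebra ℚ Gtwo) = 2 * a * evalPlus (y : MonoidAlgebra ℚ Gtwo) ∧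
      evalMinus (x : MonoidAlgebra ℚ Gtwo) = 2 * b * evalMinus (y : MonoidAlgebra ℚ Gtwo) := by
  let J : Ideal StwoSub :=
    { carrier := {y | ∀ a ∈ Zloc, ∀ b ∈ Zloc, ∃ x ∈ I,
        evalPlus (x : MonoidAlgebra ℚ Gtwo) = 2 * a * evalPlus (y : MonoidAlgebra ℚ Gtwo) ∧
        evalMinus (x : MonoidAlgebra ℚ Gtwo) = 2 * b * evalMinus (y : MonoidAlgebra ℚ Gtwo)}
      zero_mem' := fun a _ b _ => ⟨0, zero_mem _, by simp⟩
      add_mem' := by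
        intro y z hy hz a ha b hb
        obtain ⟨x, hx, hxp, hxm⟩ := hy a ha b hb
        obtain ⟨w, hw, hwp, hwm⟩ := hz a ha b hb
        refine ⟨x + w, add_mem hx hw, ?_, ?_⟩
        · simp only [Subring.coe_add, map_add, hxp, hwp]; ring
        · simp only [Subring.coe_add, map_add, hxm, hwm]; ring
      smul_mem' := by
        intro s y hy a ha b hb
        have hs := mem_StwoSub_iff.1 s.2
        obtain ⟨x, hx, hxp, hxm⟩ := hy _ (mul_mem ha hs.1) _ (mul_mem hb hs.2)
        refine ⟨x, hx, ?_, ?_⟩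
        · simp only [smul_eq_mul, Subring.coe_mul, map_mul, hxp]; ring
        · simp only [smul_eq_mul, Subring.coe_mul, map_mul, hxm]; ring }
  have hJ : Ideal.map (Subring.inclusion hRS) I ≤ J := by
    refine Ideal.map_le_iff_le_comap.2 fun x hx a ha b hb => ?_
    have hr : (2 * a) • eplus + (2 * b) • eminus ∈ RtwoSub := by
      rw [mem_RtwoSub_iff]
      simp only [map_add, map_smul, evalPlus_eplus, evalPlus_eminus, evalMinus_eplus,
        evalMinus_eminus, smul_eq_mul]
      exact ⟨by simpa using mul_mem (ofNat_mem _ 2) hb, a - b, sub_mem ha hb, by ring⟩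
    exact ⟨⟨_, hr⟩ * x, I.mul_mem_left _ hx, by simp, by simp⟩
  exact hJ hy a ha b hb

lemma subtype_inclusion_apply {A : Type*} [Ring A] {R S : Subring A} (h : R ≤ S) (x : R) :
    S.subtype (Subring.inclusion h x) = x := rfl

/-- An ideal of `R₂` whose extension to `S₂` is generated by an element `α` with nonzero
coordinates is `α R₂` or `α S₂`. -/
lemma eq_span_or_eq_span_pair_of_map_eq_span (hRS : RtwoSub ≤ StwoSub) (I : Ideal RtwoSub)
    {α : MonoidAlgebra ℚ Gtwo} (hα : α ∈ StwoSub) (hp : evalPlus α ≠ 0) (hm : evalMinus α ≠ 0)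
    (hgen : Ideal.map (Subring.inclusion hRS) I = Ideal.span {(⟨α, hα⟩ : StwoSub)}) :
    (∃ hR : α ∈ RtwoSub, I = Ideal.span {(⟨α, hR⟩ : RtwoSub)}) ∨
    (∃ (h1 : α * eplus ∈ RtwoSub) (h2 : α * eminus ∈ RtwoSub),
      I = Ideal.span {(⟨α * eplus, h1⟩ : RtwoSub), (⟨α * eminus, h2⟩ : RtwoSub)}) := by
  have hIα : ∀ x ∈ I, ∃ s ∈ StwoSub, (x : MonoidAlgebra ℚ Gtwo) = α * s := by
    intro x hx
    have hxα := hgen ▸ Ideal.mem_map_of_mem (Subring.inclusion hRS) hx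
    obtain ⟨s, hs⟩ := Ideal.mem_span_singleton'.1 hxα
    refine ⟨s, s.2, ?_⟩
    rw [mul_comm]
    have hval := congrArg StwoSub.subtype hs
    rw [map_mul, subtype_inclusion_apply] at hval
    exact hval.symm
  let N : AddSubgroup (ℚ × ℚ) :=
    { carrier := {p | ∃ x ∈ I, evalPlus (x : MonoidAlgebra ℚ Gtwo) = evalPlus α * p.1 ∧
        evalMinus (x : MonoidAlgebra ℚ Gtwo) = evalMinus α * p.2}
      zero_mem' := ⟨0, zero_mem _, by simp⟩
      add_mem' := by
        rintro p q ⟨x, hx, hxp, hxm⟩ ⟨y, hy, hyp, hym⟩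
        exact ⟨x + y, add_mem hx hy, by simp [hxp, hyp, mul_add], by simp [hxm, hym, mul_add]⟩
      neg_mem' := by
        rintro p ⟨x, hx, hxp, hxm⟩
        exact ⟨-x, neg_mem hx, by simp [hxp], by simp [hxm]⟩ }
  have mem_of_N : ∀ s : MonoidAlgebra ℚ Gtwo, (evalPlus s, evalMinus s) ∈ N →
      ∃ h : α * s ∈ RtwoSub, ⟨α * s, h⟩ ∈ I := by
    rintro s ⟨x, hx, hxp, hxm⟩
    have h : (x : MonoidAlgebra ℚ Gtwo) = α * s :=
      ext_evalPlus_evalMinus (by rw [hxp, map_mul]) (by rw [hxm, map_mul])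
    exact ⟨h ▸ x.2, by simpa only [← h] using hx⟩
  have hN : ∀ p ∈ N, p.1 ∈ Zloc ∧ p.2 ∈ Zloc := by
    rintro p ⟨x, hx, hxp, hxm⟩
    obtain ⟨s, hs, h⟩ := hIα x hx
    rw [h, map_mul] at hxp
    rw [h, map_mul] at hxm
    rw [← mul_left_cancel₀ hp hxp, ← mul_left_cancel₀ hm hxm]
    exact mem_StwoSub_iff.1 hs
  have htwo : ∀ a ∈ Zloc, ∀ b ∈ Zloc, (2 * a, 2 * b) ∈ N := by
    intro a ha b hb
    obtain ⟨x, hx, hxp, hxm⟩ := exists_mem_eval_eq_two_mul hRS I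
      (hgen ▸ Ideal.mem_span_singleton_self _) ha hb
    exact ⟨x, hx, by rw [hxp]; ring, by rw [hxm]; ring⟩
  have mem_N_of_mem : ∀ x ∈ I, (evalPlus (x : MonoidAlgebra ℚ Gtwo) / evalPlus α,
      evalMinus (x : MonoidAlgebra ℚ Gtwo) / evalMinus α) ∈ N := fun x hx =>
    ⟨x, hx, by field_simp, by field_simp⟩
  have hfst : ∃ p ∈ N, ∃ k ∈ Zloc, p.1 = 2 * k + 1 := by
    obtain ⟨x, hx, k, hk, h⟩ := exists_odd_multiple_of_map_eq_span _ I _ hgen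
      ((evalPlus : MonoidAlgebra ℚ Gtwo →+* ℚ).comp StwoSub.subtype)
      (fun s => (mem_StwoSub_iff.1 s.2).1) hp
    rw [RingHom.comp_apply, RingHom.comp_apply, subtype_inclusion_apply] at h
    replace h : evalPlus (x : MonoidAlgebra ℚ Gtwo) = evalPlus α * (2 * k + 1) := h
    exact ⟨_, mem_N_of_mem x hx, k, hk, by rw [h]; field_simp⟩
  have hsnd : ∃ p ∈ N, ∃ k ∈ Zloc, p.2 = 2 * k + 1 := by
    obtain ⟨x, hx, k, hk, h⟩ := exists_odd_multiple_of_map_eq_span _ I _ hgen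
      ((evalMinus : MonoidAlgebra ℚ Gtwo →+* ℚ).comp StwoSub.subtype)
      (fun s => (mem_StwoSub_iff.1 s.2).2) hm
    rw [RingHom.comp_apply, RingHom.comp_apply, subtype_inclusion_apply] at h
    replace h : evalMinus (x : MonoidAlgebra ℚ Gtwo) = evalMinus α * (2 * k + 1) := h
    exact ⟨_, mem_N_of_mem x hx, k, hk, by rw [h]; field_simp⟩
  obtain ⟨hone, ⟨h10, h01⟩ | hcongr⟩ := N.one_mem_and_or_congr hN htwo hfst hsnd
  · right
    obtain ⟨h1, hI1⟩ := mem_of_N eplus (by simpa using h10)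
    obtain ⟨h2, hI2⟩ := mem_of_N eminus (by simpa using h01)
    refine ⟨h1, h2, le_antisymm (fun x hx => ?_) ?_⟩
    · obtain ⟨s, hs, hxs⟩ := hIα x hx
      obtain ⟨hsp, hsm⟩ := mem_StwoSub_iff.1 hs
      have hscalar : ∀ c ∈ Zloc, algebraMap ℚ (MonoidAlgebra ℚ Gtwo) c ∈ RtwoSub := by
        intro c hc
        rw [mem_RtwoSub_iff, AlgHom.commutes, AlgHom.commutes]
        exact ⟨hc, 0, zero_mem _, by simp⟩
      refine Ideal.mem_span_pair.2 ⟨⟨_, hscalar _ hsp⟩, ⟨_, hscalar _ hsm⟩, Subtype.ext ?_⟩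
      apply ext_evalPlus_evalMinus
      · simp only [Subring.coe_add, Subring.coe_mul, map_add, map_mul, AlgHom.commutes, hxs,
          evalPlus_eplus, evalPlus_eminus, Algebra.algebraMap_self, RingHom.id_apply]
        ring
      · simp only [Subring.coe_add, Subring.coe_mul, map_add, map_mul, AlgHom.commutes, hxs,
          evalMinus_eplus, evalMinus_eminus, Algebra.algebraMap_self, RingHom.id_apply]
        ring
    · rw [Ideal.span_le, Set.pair_subset_iff]
      exact ⟨hI1, hI2⟩
  · left
    obtain ⟨hR, hI⟩ : ∃ h : α ∈ RtwoSub, ⟨α, h⟩ ∈ I := by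
      simpa only [mul_one] using mem_of_N 1 (by simpa using hone)
    refine ⟨hR, le_antisymm (fun x hx => ?_) ((Ideal.span_singleton_le_iff_mem I).2 hI)⟩
    obtain ⟨s, hs, hxs⟩ := hIα x hx
    have hsR : s ∈ RtwoSub := mem_RtwoSub_iff.2 ⟨(mem_StwoSub_iff.1 hs).2,
      hcongr (evalPlus s, evalMinus s)
        ⟨x, hx, by rw [hxs, map_mul], by rw [hxs, map_mul]⟩⟩
    exact Ideal.mem_span_singleton'.2 ⟨⟨s, hsR⟩, Subtype.ext (by rw [hxs]; exact mul_comm _ _)⟩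

/-- Let `G = ⟨τ⟩` have order 2, `R₂ = ℤ_(2)[G] ⊆ S₂` the maximal order, and let
`I ⊆ R₂` be an ideal of finite index whose extension `I·S₂` is generated by
`α = 2^i(1+τ)/2 + 2^j(1-τ)/2`.  Then `I` is either the principal ideal `(α)` or
the ideal generated by `α(1+τ)/2` and `α(1-τ)/2`. -/
theorem ideal_eq_principal_or_two_generated
    (hRS : RtwoSub ≤ StwoSub)
    (I : Ideal RtwoSub) (hfin : Finite (RtwoSub ⧸ I))
    (i j : ℕ)
    (hα : (2 : MonoidAlgebra ℚ Gtwo) ^ i * eplus +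
          (2 : MonoidAlgebra ℚ Gtwo) ^ j * eminus ∈ StwoSub)
    (hgen : Ideal.map (Subring.inclusion hRS) I =
      Ideal.span {(⟨(2 : MonoidAlgebra ℚ Gtwo) ^ i * eplus +
        (2 : MonoidAlgebra ℚ Gtwo) ^ j * eminus, hα⟩ : StwoSub)}) :
    (∃ hR : (2 : MonoidAlgebra ℚ Gtwo) ^ i * eplus +
        (2 : MonoidAlgebra ℚ Gtwo) ^ j * eminus ∈ RtwoSub,
      I = Ideal.span {(⟨(2 : MonoidAlgebra ℚ Gtwo) ^ i * eplus +
        (2 : MonoidAlgebra ℚ Gtwo) ^ j * eminus, hR⟩ : RtwoSub)}) ∨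
    (∃ (h1 : ((2 : MonoidAlgebra ℚ Gtwo) ^ i * eplus +
          (2 : MonoidAlgebra ℚ Gtwo) ^ j * eminus) * eplus ∈ RtwoSub)
       (h2 : ((2 : MonoidAlgebra ℚ Gtwo) ^ i * eplus +
          (2 : MonoidAlgebra ℚ Gtwo) ^ j * eminus) * eminus ∈ RtwoSub),
      I = Ideal.span
        {(⟨((2 : MonoidAlgebra ℚ Gtwo) ^ i * eplus +
            (2 : MonoidAlgebra ℚ Gtwo) ^ j * eminus) * eplus, h1⟩ : RtwoSub),
         (⟨((2 : MonoidAlgebra ℚ Gtwo) ^ i * eplus +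
            (2 : MonoidAlgebra ℚ Gtwo) ^ j * eminus) * eminus, h2⟩ : RtwoSub)}) := by
  have hp : evalPlus 2 = 2 := map_ofNat evalPlus 2
  have hm : evalMinus 2 = 2 := map_ofNat evalMinus 2
  exact eq_span_or_eq_span_pair_of_map_eq_span hRS I hα (by simp [hp]) (by simp [hm]) hgen
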